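/- Suppose c ∈ ℝ^m⟨⟨X⟩⟩ is a linear series, i.e., c satisfies c ∘̃ e = c + c ∘ e for every e ∈ ℝ^m⟨⟨X⟩⟩ (equivalently, c ∘ (δ + e) = c + c ∘ e). Then the feedback product w = c @ d, defined as the unique series with w = c ∘̃ (d ∘ w), satisfies w = c + (c ∘ d) ∘ w, and consequently c @ d = c + f ∘ c, where f is the unique series satisfying f = (c ∘ d) ∘̃ f (i.e., δ + f = (δ − c ∘ d)^{-1}); in δ-series notation, c @ d = (δ − c ∘ d)^{-1} ∘ c. -/

import Mathlib

open scoped BigOperators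

/-- A word over the alphabet `X = {x_0, x_1, …, x_m}`. -/
abbrev Word (m : ℕ) := List (Fin (m+1))

/-- A formal power series in `ℝ⟨⟨X⟩⟩`. -/
abbrev Series (m : ℕ) := Word m → ℝ

/-- A formal power series in `ℝ^l⟨⟨X⟩⟩`. -/
abbrev SeriesVec (l m : ℕ) := Fin l → Series m

/-- The shuffle product on `ℝ⟨⟨X⟩⟩`, defined via the coefficient recursion
`(c ⧢ d, x_i η) = (c^{x_i} ⧢ d, η) + (c ⧢ d^{x_i}, η)` which is the bilinear
extension of `(x_i η) ⧢ (x_j ξ) = x_i (η ⧢ (x_j ξ)) + x_j ((x_i η) ⧢ ξ)`. -/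
def shuffle {m : ℕ} : Series m → Series m → Series m
  | c, d, [] => c [] * d []
  | c, d, i :: η => shuffle (fun w => c (i :: w)) d η + shuffle c (fun w => d (i :: w)) η

/-- `x_ℓ c` : prepend the letter `x_ℓ` to every word of `c`. -/
def prepend {m : ℕ} (ℓ : Fin (m+1)) (c : Series m) : Series m
  | [] => 0
  | j :: w => if j = ℓ then c w else 0

/-- The left quotient `c^{x_ℓ}` : `(c^{x_ℓ}, η) = (c, x_ℓ η)`. -/
def leftQuot {m : ℕ} (ℓ : Fin (m+1)) (c : Series m) : Series m :=
  fun w => c (ℓ :: w)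

/-- The series `1∅`. -/
def oneSeries {m : ℕ} : Series m := fun w => if w = [] then 1 else 0

/-- The constant series `K∅`. -/
def constSeries {m : ℕ} (K : ℝ) : Series m := fun w => if w = [] then K else 0

/-- The component `d_ℓ` of `d ∈ ℝ^m⟨⟨X⟩⟩` indexed by letters, with `d_0 := 0`. -/
def dhat {m : ℕ} (d : Fin m → Series m) (ℓ : Fin (m+1)) : Series m :=
  Fin.cases (motive := fun _ => Series m) 0 d ℓ

/-- The component `d_ℓ` of `d ∈ ℝ^m⟨⟨X⟩⟩` indexed by letters, with `d_0 := 1`. -/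
def dtil {m : ℕ} (d : Fin m → Series m) (ℓ : Fin (m+1)) : Series m :=
  Fin.cases (motive := fun _ => Series m) oneSeries d ℓ

/-- `φ_d(x_ℓ)(e) = x_ℓ e + x_0 (d_ℓ ⧢ e)` with `d_0 := 0`. -/
def phiLetter {m : ℕ} (d : Fin m → Series m) (ℓ : Fin (m+1)) (e : Series m) : Series m :=
  prepend ℓ e + prepend 0 (shuffle (dhat d ℓ) e)

/-- `φ_d(η)` for a word `η`, with `φ_d(∅) = id` and `φ_d(x_ℓ η) = φ_d(x_ℓ) ∘ φ_d(η)`. -/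
def phi {m : ℕ} (d : Fin m → Series m) : Word m → Series m → Series m
  | [], e => e
  | ℓ :: η, e => phiLetter d ℓ (phi d η e)

/-- The modified composition product `c ∘̃ d = Σ_{η ∈ X*} (c, η) φ_d(η)(1)`.
Since `φ_d(η)(1)` has no words of length `< |η|`, the coefficient of a word `ν`
is given by the (finite) sum over all words `η` with `|η| ≤ |ν|`. -/
def modComp {m : ℕ} (c : Series m) (d : Fin m → Series m) : Series m :=
  fun ν => ∑ k ∈ Finset.range (ν.length + 1), ∑ η : Fin k → Fin (m+1),
    c (List.ofFn η) * phi d (List.ofFn η) oneSeries ν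

/-- The modified composition product on `ℝ^l⟨⟨X⟩⟩`, componentwise. -/
def modCompVec {l m : ℕ} (c : SeriesVec l m) (d : SeriesVec m m) : SeriesVec l m :=
  fun i => modComp (c i) d

/-- `ψ_d(x_ℓ)(e) = x_0 (d_ℓ ⧢ e)` with `d_0 := 1`. -/
def psiLetter {m : ℕ} (d : Fin m → Series m) (ℓ : Fin (m+1)) (e : Series m) : Series m :=
  prepend 0 (shuffle (dtil d ℓ) e)

/-- `ψ_d(η)` for a word `η`, with `ψ_d(∅) = id` and `ψ_d(x_ℓ η) = ψ_d(x_ℓ) ∘ ψ_d(η)`. -/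
def psi {m : ℕ} (d : Fin m → Series m) : Word m → Series m → Series m
  | [], e => e
  | ℓ :: η, e => psiLetter d ℓ (psi d η e)

/-- The composition product `c ∘ d = Σ_{η ∈ X*} (c, η) ψ_d(η)(1)`. -/
def comp {m : ℕ} (c : Series m) (d : Fin m → Series m) : Series m :=
  fun ν => ∑ k ∈ Finset.range (ν.length + 1), ∑ η : Fin k → Fin (m+1),
    c (List.ofFn η) * psi d (List.ofFn η) oneSeries ν

/-- The composition product on `ℝ^l⟨⟨X⟩⟩`, componentwise. -/
def compVec {l m : ℕ} (c : SeriesVec l m) (d : SeriesVec m m) : SeriesVec l m :=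
  fun i => comp (c i) d

/-- The group product `c ⊚ d := d + c ∘̃ d` of the output feedback group,
so that `(δ + c) ∘ (δ + d) = δ + c ⊚ d`. -/
def oplus {m : ℕ} (c d : SeriesVec m m) : SeriesVec m m :=
  d + modCompVec c d

section Shuffle

variable {m : ℕ}

lemma shuffle_nil (a b : Series m) : shuffle a b [] = a [] * b [] := by
  rw [shuffle]

lemma shuffle_cons (a b : Series m) (i : Fin (m+1)) (ν : Word m) :
    shuffle a b (i :: ν) = shuffle (leftQuot i a) b ν + shuffle a (leftQuot i b) ν := by
  rw [shuffle]; rfl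

lemma leftQuot_shuffle (i : Fin (m+1)) (a b : Series m) :
    leftQuot i (shuffle a b) = shuffle (leftQuot i a) b + shuffle a (leftQuot i b) :=
  funext fun ν => shuffle_cons a b i ν

lemma leftQuot_add (i : Fin (m+1)) (a b : Series m) :
    leftQuot i (a + b) = leftQuot i a + leftQuot i b := rfl

lemma leftQuot_smul (i : Fin (m+1)) (r : ℝ) (a : Series m) :
    leftQuot i (r • a) = r • leftQuot i a := rfl

lemma leftQuot_oneSeries (i : Fin (m+1)) : leftQuot i (oneSeries : Series m) = 0 := by
  funext ν; simp [leftQuot, oneSeries]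

lemma shuffle_comm (a b : Series m) : shuffle a b = shuffle b a := by
  funext ν
  induction ν generalizing a b with
  | nil => simp [shuffle_nil, mul_comm]
  | cons i ν ih => rw [shuffle_cons, shuffle_cons, ih, ih a, add_comm]

lemma shuffle_add (a b b' : Series m) : shuffle a (b + b') = shuffle a b + shuffle a b' := by
  funext ν
  induction ν generalizing a b b' with
  | nil => simp [shuffle_nil, mul_add]
  | cons i ν ih =>
    simp only [Pi.add_apply, shuffle_cons, leftQuot_add, ih]
    ring

lemma shuffle_smul (r : ℝ) (a b : Series m) : shuffle a (r • b) = r • shuffle a b := by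
  funext ν
  induction ν generalizing a b with
  | nil => simp [shuffle_nil, mul_left_comm]
  | cons i ν ih =>
    simp only [Pi.smul_apply, shuffle_cons, leftQuot_smul, ih, smul_add]

lemma add_shuffle (a a' b : Series m) : shuffle (a + a') b = shuffle a b + shuffle a' b := by
  rw [shuffle_comm, shuffle_add, shuffle_comm b, shuffle_comm b]

/-- Shuffling with `a` on the left, as a linear map. -/
def shuffleLin (a : Series m) : Series m →ₗ[ℝ] Series m where
  toFun := shuffle a
  map_add' := shuffle_add a
  map_smul' r b := shuffle_smul r a b

lemma shuffle_zero (a : Series m) : shuffle a 0 = 0 := (shuffleLin a).map_zero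

lemma zero_shuffle (a : Series m) : shuffle 0 a = 0 := by rw [shuffle_comm, shuffle_zero]

lemma shuffle_sum {ι : Type*} (s : Finset ι) (a : Series m) (b : ι → Series m) :
    shuffle a (∑ i ∈ s, b i) = ∑ i ∈ s, shuffle a (b i) :=
  map_sum (shuffleLin a) b s

lemma sum_shuffle {ι : Type*} (s : Finset ι) (a : ι → Series m) (b : Series m) :
    shuffle (∑ i ∈ s, a i) b = ∑ i ∈ s, shuffle (a i) b := by
  simp only [shuffle_comm _ b, shuffle_sum]

lemma oneSeries_shuffle (a : Series m) : shuffle oneSeries a = a := by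
  funext ν
  induction ν generalizing a with
  | nil => simp [shuffle_nil, oneSeries]
  | cons i ν ih =>
    rw [shuffle_cons, ih, leftQuot_oneSeries, zero_shuffle]
    simp [leftQuot]

lemma shuffle_assoc (a b c : Series m) :
    shuffle (shuffle a b) c = shuffle a (shuffle b c) := by
  funext ν
  induction ν generalizing a b c with
  | nil => simp [shuffle_nil, mul_assoc]
  | cons i ν ih =>
    simp only [shuffle_cons, leftQuot_shuffle, add_shuffle, shuffle_add, Pi.add_apply, ih]
    ring

/-- The coefficient of `ν` in a shuffle product depends only on words no longer than `ν`. -/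
lemma shuffle_congr {a a' b b' : Series m} {ν : Word m}
    (ha : ∀ μ : Word m, μ.length ≤ ν.length → a μ = a' μ)
    (hb : ∀ μ : Word m, μ.length ≤ ν.length → b μ = b' μ) :
    shuffle a b ν = shuffle a' b' ν := by
  induction ν generalizing a a' b b' with
  | nil => simp [shuffle_nil, ha [] le_rfl, hb [] le_rfl]
  | cons i ν ih =>
    rw [shuffle_cons, shuffle_cons]
    congr 1
    · exact ih (fun μ h => ha _ (by simpa using h))
        (fun μ h => hb _ (h.trans (by simp)))
    · exact ih (fun μ h => ha _ (h.trans (by simp)))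
        (fun μ h => hb _ (by simpa using h))

end Shuffle

section Expansion

variable {m : ℕ}

/-- The series `Σ_η (c, η) L(η)(1)`, where `L(x_i η) = L(x_i) ∘ L(η)`. -/
def expand (L : Fin (m+1) → Series m →ₗ[ℝ] Series m) (c : Series m) : Series m :=
  fun ν => ∑ k ∈ Finset.range (ν.length + 1), ∑ η : Fin k → Fin (m+1),
    c (List.ofFn η) * (List.ofFn η).foldr (fun ℓ e => L ℓ e) oneSeries ν

/-- `L` is strictly causal: the coefficient of `ν` in `L e` depends only on the coefficients of
`e` at words shorter than `ν`. -/
def StrictlyCausal (L : Series m →ₗ[ℝ] Series m) : Prop :=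
  ∀ (e : Series m) (ν : Word m), (∀ μ : Word m, μ.length < ν.length → e μ = 0) → L e ν = 0

lemma StrictlyCausal.congr {L : Series m →ₗ[ℝ] Series m} (hL : StrictlyCausal L)
    {e e' : Series m} {ν : Word m} (h : ∀ μ : Word m, μ.length < ν.length → e μ = e' μ) :
    L e ν = L e' ν := by
  have := hL (e - e') ν fun μ hμ => by simp [h μ hμ]
  rw [map_sub, Pi.sub_apply] at this
  exact sub_eq_zero.mp this

variable {L : Fin (m+1) → Series m →ₗ[ℝ] Series m}

lemma foldr_eq_zero_of_length_lt (hL : ∀ ℓ, StrictlyCausal (L ℓ)) (η ν : Word m)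
    (h : ν.length < η.length) : η.foldr (fun ℓ e => L ℓ e) oneSeries ν = 0 := by
  induction η generalizing ν with
  | nil => simp at h
  | cons ℓ η ih =>
    refine hL ℓ _ ν fun μ hμ => ih μ ?_
    simp only [List.length_cons] at h
    omega

lemma expand_eq_sum_range (hL : ∀ ℓ, StrictlyCausal (L ℓ)) (c : Series m) (ν : Word m) {n : ℕ}
    (hn : ν.length < n) :
    expand L c ν = ∑ k ∈ Finset.range n, ∑ η : Fin k → Fin (m+1),
      c (List.ofFn η) * (List.ofFn η).foldr (fun ℓ e => L ℓ e) oneSeries ν := by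
  refine Finset.sum_subset (Finset.range_subset_range.mpr hn) fun k _ hk => ?_
  refine Finset.sum_eq_zero fun η _ => ?_
  rw [foldr_eq_zero_of_length_lt hL, mul_zero]
  simp only [Finset.mem_range] at hk
  simp only [List.length_ofFn]
  omega

lemma expand_eq (hL : ∀ ℓ, StrictlyCausal (L ℓ)) (c : Series m) :
    expand L c = c [] • oneSeries + ∑ ℓ, L ℓ (expand L (leftQuot ℓ c)) := by
  funext ν
  have key : ∀ ℓ, L ℓ (expand L (leftQuot ℓ c)) ν =
      ∑ k ∈ Finset.range ν.length, ∑ η : Fin k → Fin (m+1), c (ℓ :: List.ofFn η) *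
        L ℓ ((List.ofFn η).foldr (fun ℓ e => L ℓ e) oneSeries) ν := by
    intro ℓ
    rw [(hL ℓ).congr (e' := ∑ k ∈ Finset.range ν.length, ∑ η : Fin k → Fin (m+1),
      c (ℓ :: List.ofFn η) • (List.ofFn η).foldr (fun ℓ e => L ℓ e) oneSeries)]
    · simp [map_sum, Finset.sum_apply]
    · intro μ hμ
      rw [expand_eq_sum_range hL _ _ hμ]
      simp [Finset.sum_apply, leftQuot]
  have split : ∀ k, ∑ η : Fin (k + 1) → Fin (m+1),
      c (List.ofFn η) * (List.ofFn η).foldr (fun ℓ e => L ℓ e) oneSeries ν =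
      ∑ ℓ, ∑ η : Fin k → Fin (m+1), c (ℓ :: List.ofFn η) *
        L ℓ ((List.ofFn η).foldr (fun ℓ e => L ℓ e) oneSeries) ν := by
    intro k
    rw [← (Fin.consEquiv fun _ => Fin (m+1)).sum_comp, Fintype.sum_prod_type]
    simp [Fin.consEquiv, List.ofFn_succ]
  simp only [Pi.add_apply, Finset.sum_apply, Pi.smul_apply, smul_eq_mul, key]
  rw [expand, Finset.sum_range_succ', add_comm, Finset.sum_comm]
  simp only [split]
  simp

lemma expand_add (c c' : Series m) : expand L (c + c') = expand L c + expand L c' := by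
  funext ν
  simp [expand, add_mul, Finset.sum_add_distrib]

lemma expand_smul (r : ℝ) (c : Series m) : expand L (r • c) = r • expand L c := by
  funext ν
  simp [expand, Finset.mul_sum, mul_assoc]

end Expansion

section Composition

variable {m : ℕ}

lemma prepend_cons_self (ℓ : Fin (m+1)) (a : Series m) (ν : Word m) :
    prepend ℓ a (ℓ :: ν) = a ν := by simp [prepend]

lemma prepend_cons_of_ne {j ℓ : Fin (m+1)} (h : j ≠ ℓ) (a : Series m) (ν : Word m) :
    prepend ℓ a (j :: ν) = 0 := by simp [prepend, h]

/-- Prepending a letter, as a linear map. -/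
def prependLin (ℓ : Fin (m+1)) : Series m →ₗ[ℝ] Series m where
  toFun := prepend ℓ
  map_add' a b := by
    funext ν
    cases ν with
    | nil => simp [prepend]
    | cons j ν => by_cases h : j = ℓ <;> simp [prepend, h]
  map_smul' r a := by
    funext ν
    cases ν with
    | nil => simp [prepend]
    | cons j ν => by_cases h : j = ℓ <;> simp [prepend, h]

lemma strictlyCausal_prepend_shuffle (ℓ : Fin (m+1)) (a : Series m) :
    StrictlyCausal (prependLin ℓ ∘ₗ shuffleLin a) := by
  intro e ν h
  change prepend ℓ (shuffle a e) ν = 0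
  cases ν with
  | nil => rfl
  | cons j ν =>
    have : shuffle a e ν = 0 := by
      rw [shuffle_congr (a' := a) (b' := 0) (fun _ _ => rfl)
        (fun μ hμ => h μ (by simpa using Nat.lt_succ_of_le hμ)), shuffle_zero, Pi.zero_apply]
    simp [prepend, this]

/-- The letter operators `ψ_d(x_ℓ)`, as linear maps. -/
def psiLin (d : Fin m → Series m) (ℓ : Fin (m+1)) : Series m →ₗ[ℝ] Series m :=
  prependLin 0 ∘ₗ shuffleLin (dtil d ℓ)

/-- The letter operators `φ_d(x_ℓ)`, as linear maps. -/
def phiLin (d : Fin m → Series m) (ℓ : Fin (m+1)) : Series m →ₗ[ℝ] Series m :=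
  prependLin ℓ + prependLin 0 ∘ₗ shuffleLin (dhat d ℓ)

lemma strictlyCausal_psiLin (d : Fin m → Series m) (ℓ : Fin (m+1)) :
    StrictlyCausal (psiLin d ℓ) :=
  strictlyCausal_prepend_shuffle _ _

lemma strictlyCausal_phiLin (d : Fin m → Series m) (ℓ : Fin (m+1)) :
    StrictlyCausal (phiLin d ℓ) := by
  intro e ν h
  have h₁ := strictlyCausal_prepend_shuffle ℓ oneSeries e ν h
  have h₂ := strictlyCausal_prepend_shuffle 0 (dhat d ℓ) e ν h
  change prepend ℓ (shuffle oneSeries e) ν = 0 at h₁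
  rw [oneSeries_shuffle] at h₁
  change prepend ℓ e ν + (prependLin 0 ∘ₗ shuffleLin (dhat d ℓ)) e ν = 0
  rw [h₁, h₂, add_zero]

lemma psi_eq_foldr (d : Fin m → Series m) (η : Word m) (e : Series m) :
    psi d η e = η.foldr (fun ℓ e => psiLin d ℓ e) e := by
  induction η with
  | nil => rfl
  | cons ℓ η ih => rw [psi, ih]; rfl

lemma phi_eq_foldr (d : Fin m → Series m) (η : Word m) (e : Series m) :
    phi d η e = η.foldr (fun ℓ e => phiLin d ℓ e) e := by
  induction η with
  | nil => rfl
  | cons ℓ η ih => rw [phi, ih]; rfl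

lemma comp_eq_expand (c : Series m) (d : Fin m → Series m) :
    comp c d = expand (psiLin d) c := by
  funext ν
  simp only [comp, expand, psi_eq_foldr]

lemma modComp_eq_expand (c : Series m) (d : Fin m → Series m) :
    modComp c d = expand (phiLin d) c := by
  funext ν
  simp only [modComp, expand, phi_eq_foldr]

lemma comp_eq (c : Series m) (d : Fin m → Series m) :
    comp c d = c [] • oneSeries +
      ∑ ℓ, prepend 0 (shuffle (dtil d ℓ) (comp (leftQuot ℓ c) d)) := by
  simp only [comp_eq_expand]
  exact expand_eq (strictlyCausal_psiLin d) c

lemma modComp_eq (c : Series m) (d : Fin m → Series m) :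
    modComp c d = c [] • oneSeries + ∑ ℓ, (prepend ℓ (modComp (leftQuot ℓ c) d) +
      prepend 0 (shuffle (dhat d ℓ) (modComp (leftQuot ℓ c) d))) := by
  simp only [modComp_eq_expand]
  exact expand_eq (strictlyCausal_phiLin d) c

lemma comp_nil (c : Series m) (d : Fin m → Series m) : comp c d [] = c [] := by
  rw [comp_eq]; simp [prepend, oneSeries]

lemma leftQuot_comp_zero (c : Series m) (d : Fin m → Series m) :
    leftQuot 0 (comp c d) = ∑ ℓ, shuffle (dtil d ℓ) (comp (leftQuot ℓ c) d) := by
  funext ν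
  rw [leftQuot, comp_eq]; simp [prepend_cons_self, oneSeries]

lemma leftQuot_comp_of_ne {j : Fin (m+1)} (hj : j ≠ 0) (c : Series m) (d : Fin m → Series m) :
    leftQuot j (comp c d) = 0 := by
  funext ν
  rw [leftQuot, comp_eq]; simp [prepend_cons_of_ne hj, oneSeries]

lemma modComp_nil (c : Series m) (d : Fin m → Series m) : modComp c d [] = c [] := by
  rw [modComp_eq]; simp [prepend, oneSeries]

lemma leftQuot_modComp (j : Fin (m+1)) (c : Series m) (d : Fin m → Series m) :
    leftQuot j (modComp c d) = modComp (leftQuot j c) d +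
      if j = 0 then ∑ ℓ, shuffle (dhat d ℓ) (modComp (leftQuot ℓ c) d) else 0 := by
  funext ν
  rw [leftQuot, modComp_eq]
  by_cases h : j = 0
  · subst h
    simp [prepend, oneSeries, Finset.sum_add_distrib]
  · simp [prepend, oneSeries, h]

/-- Composition with `d` on the right, as a linear map. -/
def compLin (d : Fin m → Series m) : Series m →ₗ[ℝ] Series m where
  toFun c := comp c d
  map_add' a b := by simp only [comp_eq_expand, expand_add]
  map_smul' r a := by simp only [comp_eq_expand, expand_smul]; rfl

lemma add_comp (a b : Series m) (d : Fin m → Series m) :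
    comp (a + b) d = comp a d + comp b d := (compLin d).map_add a b

lemma zero_comp (d : Fin m → Series m) : comp 0 d = 0 := (compLin d).map_zero

lemma sum_comp {ι : Type*} (s : Finset ι) (a : ι → Series m) (d : Fin m → Series m) :
    comp (∑ i ∈ s, a i) d = ∑ i ∈ s, comp (a i) d := map_sum (compLin d) a s

lemma oneSeries_comp (d : Fin m → Series m) : comp oneSeries d = oneSeries := by
  rw [comp_eq]
  simp only [leftQuot_oneSeries, zero_comp, shuffle_zero]
  have : prepend 0 (0 : Series m) = 0 := (prependLin 0).map_zero
  simp [this, oneSeries]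

lemma shuffle_comp (a b : Series m) (d : Fin m → Series m) :
    comp (shuffle a b) d = shuffle (comp a d) (comp b d) := by
  suffices H : ∀ (n : ℕ) (ν : Word m), ν.length ≤ n → ∀ a b : Series m,
      comp (shuffle a b) d ν = shuffle (comp a d) (comp b d) ν from
    funext fun ν => H _ ν le_rfl a b
  intro n
  induction n with
  | zero =>
    intro ν hν a b
    obtain rfl : ν = [] := by simpa using hν
    simp [comp_nil, shuffle_nil]
  | succ n ih =>
    intro ν hν a b
    cases ν with
    | nil => simp [comp_nil, shuffle_nil]
    | cons j ν =>
      have hν' : ν.length ≤ n := by simpa using hν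
      rw [shuffle_cons]
      change leftQuot j (comp (shuffle a b) d) ν = _
      by_cases hj : j = 0
      · subst hj
        simp only [leftQuot_comp_zero, leftQuot_shuffle, add_comp, shuffle_add, sum_shuffle,
          shuffle_sum, Finset.sum_apply, Pi.add_apply, Finset.sum_add_distrib]
        congr 1 <;> refine Finset.sum_congr rfl fun ℓ _ => ?_
        · rw [shuffle_assoc]
          exact shuffle_congr (fun _ _ => rfl) fun μ hμ => ih μ (hμ.trans hν') _ _
        · rw [← shuffle_assoc, shuffle_comm (comp a d), shuffle_assoc]
          exact shuffle_congr (fun _ _ => rfl) fun μ hμ => ih μ (hμ.trans hν') _ _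
      · simp [leftQuot_comp_of_ne hj, zero_shuffle, shuffle_zero]

lemma dtil_comp (d e : SeriesVec m m) (ℓ : Fin (m+1)) :
    comp (dtil d ℓ) e = dtil (compVec d e) ℓ := by
  cases ℓ using Fin.cases with
  | zero => exact oneSeries_comp e
  | succ i => rfl

lemma dtil_add_compVec (c f : SeriesVec m m) (ℓ : Fin (m+1)) :
    dtil (c + compVec f c) ℓ = dtil c ℓ + comp (dhat f ℓ) c := by
  cases ℓ using Fin.cases with
  | zero =>
    change oneSeries = oneSeries + comp 0 c
    rw [zero_comp, add_zero]
  | succ i => rfl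

/-- The composition product is determined by its recursion: any family `F c` of series with the
constant terms and left quotients of `c ∘ e` is `c ∘ e`. -/
lemma eq_comp_of_leftQuot (e : SeriesVec m m) (F : Series m → Series m)
    (hnil : ∀ c, F c [] = c [])
    (hne : ∀ c j, j ≠ 0 → leftQuot j (F c) = 0)
    (hzero : ∀ c, leftQuot 0 (F c) = ∑ ℓ, shuffle (dtil e ℓ) (F (leftQuot ℓ c)))
    (c : Series m) : F c = comp c e := by
  suffices H : ∀ (n : ℕ) (ν : Word m), ν.length ≤ n → ∀ c : Series m, F c ν = comp c e ν from
    funext fun ν => H _ ν le_rfl c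
  intro n
  induction n with
  | zero =>
    intro ν hν c
    obtain rfl : ν = [] := by simpa using hν
    rw [hnil, comp_nil]
  | succ n ih =>
    intro ν hν c
    cases ν with
    | nil => rw [hnil, comp_nil]
    | cons j ν =>
      have hν' : ν.length ≤ n := by simpa using hν
      change leftQuot j (F c) ν = leftQuot j (comp c e) ν
      by_cases hj : j = 0
      · subst hj
        rw [hzero, leftQuot_comp_zero, Finset.sum_apply, Finset.sum_apply]
        exact Finset.sum_congr rfl fun ℓ _ =>
          shuffle_congr (fun _ _ => rfl) fun μ hμ => ih μ (hμ.trans hν') _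
      · rw [hne c j hj, leftQuot_comp_of_ne hj]

lemma comp_assoc (c : Series m) (d e : SeriesVec m m) :
    comp (comp c d) e = comp c (compVec d e) := by
  refine eq_comp_of_leftQuot (compVec d e) (fun c => comp (comp c d) e)
    (fun c => by rw [comp_nil, comp_nil]) (fun c j hj => leftQuot_comp_of_ne hj _ _)
    (fun c => ?_) c
  have hvanish : ∀ ℓ, ℓ ≠ 0 → shuffle (dtil e ℓ) (comp (leftQuot ℓ (comp c d)) e) = 0 := by
    intro ℓ hℓ
    rw [leftQuot_comp_of_ne hℓ, zero_comp, shuffle_zero]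
  rw [leftQuot_comp_zero, Fintype.sum_eq_single 0 hvanish, leftQuot_comp_zero]
  change shuffle oneSeries _ = _
  simp only [oneSeries_shuffle, sum_comp, shuffle_comp, dtil_comp]

lemma modComp_comp (g : Series m) (f c : SeriesVec m m) :
    comp (modComp g f) c = comp g (c + compVec f c) := by
  refine eq_comp_of_leftQuot (c + compVec f c) (fun g => comp (modComp g f) c)
    (fun g => by rw [comp_nil, modComp_nil]) (fun g j hj => leftQuot_comp_of_ne hj _ _)
    (fun g => ?_) g
  have hvanish : ∀ ℓ : Fin (m+1), ℓ ≠ 0 → shuffle (dtil c ℓ) (comp (if ℓ = 0 then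
      ∑ k, shuffle (dhat f k) (modComp (leftQuot k g) f) else 0) c) = 0 := by
    intro ℓ hℓ
    rw [if_neg hℓ, zero_comp, shuffle_zero]
  simp only [leftQuot_comp_zero, leftQuot_modComp, add_comp, shuffle_add, Finset.sum_add_distrib,
    dtil_add_compVec, add_shuffle]
  congr 1
  rw [Fintype.sum_eq_single 0 hvanish, if_pos rfl]
  change shuffle oneSeries _ = _
  simp only [oneSeries_shuffle, sum_comp, shuffle_comp]

/-- The coefficient of `ν` in `c ∘ d` depends on `d` only at words shorter than `ν`. -/
lemma comp_congr_right (c : Series m) {d d' : SeriesVec m m} {ν : Word m}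
    (h : ∀ i (μ : Word m), μ.length < ν.length → d i μ = d' i μ) :
    comp c d ν = comp c d' ν := by
  suffices H : ∀ (n : ℕ) (ν : Word m), ν.length ≤ n →
      (∀ i (μ : Word m), μ.length < ν.length → d i μ = d' i μ) →
      ∀ c : Series m, comp c d ν = comp c d' ν from H _ ν le_rfl h c
  intro n
  induction n with
  | zero =>
    intro ν hν _ c
    obtain rfl : ν = [] := by simpa using hν
    rw [comp_nil, comp_nil]
  | succ n ih =>
    intro ν hν h c
    cases ν with
    | nil => rw [comp_nil, comp_nil]
    | cons j ν =>
      have hν' : ν.length ≤ n := by simpa using hν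
      have hlt : ∀ μ : Word m, μ.length ≤ ν.length → μ.length < (j :: ν).length :=
        fun μ hμ => by simpa using Nat.lt_succ_of_le hμ
      change leftQuot j (comp c d) ν = leftQuot j (comp c d') ν
      by_cases hj : j = 0
      · subst hj
        rw [leftQuot_comp_zero, leftQuot_comp_zero, Finset.sum_apply, Finset.sum_apply]
        refine Finset.sum_congr rfl fun ℓ _ => shuffle_congr (fun μ hμ => ?_) fun μ hμ =>
          ih μ (hμ.trans hν') (fun i κ hκ => h i κ (hκ.trans (hlt μ hμ))) _
        cases ℓ using Fin.cases with
        | zero => rfl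
        | succ i => exact h i μ (hlt μ hμ)
      · rw [leftQuot_comp_of_ne hj, leftQuot_comp_of_ne hj]

/-- The equation `v = c + g ∘ v` has at most one solution `v`. -/
lemma eq_of_eq_add_compVec {c g v v' : SeriesVec m m} (hv : v = c + compVec g v)
    (hv' : v' = c + compVec g v') : v = v' := by
  suffices H : ∀ (n : ℕ) (i : Fin m) (ν : Word m), ν.length < n → v i ν = v' i ν from
    funext fun i => funext fun ν => H _ i ν (Nat.lt_succ_self _)
  intro n
  induction n with
  | zero => intro i ν hν; omega
  | succ n ih =>
    intro i ν hν
    rw [hv, hv']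
    change c i ν + comp (g i) v ν = c i ν + comp (g i) v' ν
    rw [comp_congr_right (g i) fun k μ hμ => ih k μ (by omega)]

end Composition

/-- if `c` is a linear series, i.e. `c ∘̃ e = c + c ∘ e` for
every `e`, then the feedback product `w = c @ d` (the unique series with
`w = c ∘̃ (d ∘ w)`) satisfies `w = c + (c ∘ d) ∘ w`, and consequently
`c @ d = c + f ∘ c` where `f` is the unique series with `f = (c ∘ d) ∘̃ f`
(i.e. `δ + f = (δ − c ∘ d)⁻¹`); in `δ`-series notation,
`c @ d = (δ − c ∘ d)⁻¹ ∘ c`. -/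
theorem feedbackProduct_linear_case (m : ℕ) (c d w f : SeriesVec m m)
    (hlin : ∀ e : SeriesVec m m, modCompVec c e = c + compVec c e)
    (hw : w = modCompVec c (compVec d w))
    (hf : f = modCompVec (compVec c d) f) :
    w = c + compVec (compVec c d) w ∧ w = c + compVec f c := by
  have hw' : w = c + compVec (compVec c d) w := by
    have hassoc : compVec (compVec c d) w = compVec c (compVec d w) :=
      funext fun i => comp_assoc (c i) d w
    rw [hassoc, ← hlin]
    exact hw
  have hfc : compVec f c = compVec (compVec c d) (c + compVec f c) := by
    conv_lhs => rw [hf]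
    exact funext fun i => modComp_comp (compVec c d i) f c
  exact ⟨hw', eq_of_eq_add_compVec hw' (congrArg (c + ·) hfc)⟩
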